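/- There exist a metric space X, a skew-evolution semiflow C = (φ,Φ) on X × ℝ² (with ℝ² normed by ‖(v₁,v₂)‖ = |v₁| + |v₂|), and projectors P₁, P₂ compatible with C, such that C is Barreira–Valls polynomially dichotomic with respect to P₁, P₂, but for every choice of constants N ≥ 1 and α₁, α₂, β₁, β₂ > 0 the Barreira–Valls exponential dichotomy estimates with respect to P₁, P₂ fail; that is, C is not Barreira–Valls exponentially dichotomic with respect to P₁, P₂. -/

import Mathlib

open Real MeasureTheory

section SkewEvolution

variable {X : Type*} [MetricSpace X] {V : Type*} [NormedAddCommGroup V] [NormedSpace ℝ V]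

/-- `φ : T × X → X` is an evolution semiflow (`φ t s x` for `t ≥ s ≥ 0`). -/
def IsEvolutionSemiflow (φ : ℝ → ℝ → X → X) : Prop :=
  (∀ t x, 0 ≤ t → φ t t x = x) ∧
  ∀ t s t₀ x, 0 ≤ t₀ → t₀ ≤ s → s ≤ t → φ t s (φ s t₀ x) = φ t t₀ x

/-- `Φ : T × X → B(V)` is an evolution cocycle over the evolution semiflow `φ`. -/
def IsEvolutionCocycle (φ : ℝ → ℝ → X → X) (Φ : ℝ → ℝ → X → (V →L[ℝ] V)) : Prop :=
  (∀ t x, 0 ≤ t → Φ t t x = ContinuousLinearMap.id ℝ V) ∧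
  ∀ t s t₀ x, 0 ≤ t₀ → t₀ ≤ s → s ≤ t →
    (Φ t s (φ s t₀ x)).comp (Φ s t₀ x) = Φ t t₀ x

/-- `C = (φ, Φ)` is a skew-evolution semiflow on `X × V`. -/
def IsSkewEvolutionSemiflow (φ : ℝ → ℝ → X → X) (Φ : ℝ → ℝ → X → (V →L[ℝ] V)) : Prop :=
  IsEvolutionSemiflow φ ∧ IsEvolutionCocycle φ Φ

/-- A projector on `X × V`: each `P x` is a bounded linear projection and
`(x, v) ↦ P x v` is continuous. -/
def IsProjector (P : X → (V →L[ℝ] V)) : Prop :=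
  (∀ x, (P x).comp (P x) = P x) ∧ Continuous fun p : X × V => P p.1 p.2

/-- A projector invariant relative to the skew-evolution semiflow `C = (φ, Φ)`. -/
def IsInvariantProjector (φ : ℝ → ℝ → X → X) (Φ : ℝ → ℝ → X → (V →L[ℝ] V))
    (P : X → (V →L[ℝ] V)) : Prop :=
  IsProjector P ∧
  ∀ t s x, 0 ≤ s → s ≤ t → (P (φ t s x)).comp (Φ t s x) = (Φ t s x).comp (P x)

/-- Projectors `P₁, P₂` compatible with `C = (φ, Φ)`: `P₂ x = I - P₁ x` and both
are invariant relative to `C`. -/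
def CompatibleProjectors (φ : ℝ → ℝ → X → X) (Φ : ℝ → ℝ → X → (V →L[ℝ] V))
    (P₁ P₂ : X → (V →L[ℝ] V)) : Prop :=
  (∀ x, P₂ x = ContinuousLinearMap.id ℝ V - P₁ x) ∧
  IsInvariantProjector φ Φ P₁ ∧ IsInvariantProjector φ Φ P₂

/-- `C` has exponential growth. -/
def HasExpGrowth (Φ : ℝ → ℝ → X → (V →L[ℝ] V)) : Prop :=
  ∃ M ω : ℝ → ℝ, (∀ s, 0 ≤ s → 0 < M s) ∧ (∀ s, 0 ≤ s → 0 < ω s) ∧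
    ∀ t s t₀ (x : X) (v : V), 0 ≤ t₀ → t₀ ≤ s → s ≤ t →
      ‖Φ t t₀ x v‖ ≤ M s * Real.exp (ω s * (t - s)) * ‖Φ s t₀ x v‖

/-- `C` has exponential decay. -/
def HasExpDecay (Φ : ℝ → ℝ → X → (V →L[ℝ] V)) : Prop :=
  ∃ M ω : ℝ → ℝ, (∀ t, 0 ≤ t → 0 < M t) ∧ (∀ t, 0 ≤ t → 0 < ω t) ∧
    ∀ t s t₀ (x : X) (v : V), 0 ≤ t₀ → t₀ ≤ s → s ≤ t →
      ‖Φ s t₀ x v‖ ≤ M t * Real.exp (ω t * (t - s)) * ‖Φ t t₀ x v‖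

/-- `C` has bounded exponential growth. -/
def HasBoundedExpGrowth (Φ : ℝ → ℝ → X → (V →L[ℝ] V)) : Prop :=
  ∃ M ω : ℝ, 1 ≤ M ∧ 0 < ω ∧
    ∀ t s (x : X), 0 ≤ s → s ≤ t → ‖Φ t s x‖ ≤ M * Real.exp (ω * (t - s))

/-- `C` has uniform exponential decay. -/
def HasUnifExpDecay (Φ : ℝ → ℝ → X → (V →L[ℝ] V)) : Prop :=
  ∃ M ω : ℝ, 1 ≤ M ∧ 0 < ω ∧
    ∀ t s t₀ (x : X) (v : V), 0 ≤ t₀ → t₀ ≤ s → s ≤ t →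
      ‖Φ s t₀ x v‖ ≤ M * Real.exp (ω * (t - s)) * ‖Φ t t₀ x v‖

/-- `C` is strongly measurable: `s ↦ ‖Φ(s, t₀, x) v‖` is measurable on `[t₀, ∞)`. -/
def IsStronglyMeasurableSES (Φ : ℝ → ℝ → X → (V →L[ℝ] V)) : Prop :=
  ∀ t₀ (x : X) (v : V), 0 ≤ t₀ →
    Measurable fun s : Set.Ici t₀ => ‖Φ (s : ℝ) t₀ x v‖

/-- Uniform exponential dichotomy with respect to compatible projectors `P₁, P₂`. -/
def IsUnifExpDichotomic (Φ : ℝ → ℝ → X → (V →L[ℝ] V))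
    (P₁ P₂ : X → (V →L[ℝ] V)) : Prop :=
  ∃ N₁ N₂ ν₁ ν₂ : ℝ, 1 ≤ N₁ ∧ 1 ≤ N₂ ∧ 0 < ν₁ ∧ 0 < ν₂ ∧
    ∀ t s t₀ (x : X) (v : V), 0 ≤ t₀ → t₀ ≤ s → s ≤ t →
      Real.exp (ν₁ * (t - s)) * ‖Φ t t₀ x (P₁ x v)‖ ≤ N₁ * ‖Φ s t₀ x (P₁ x v)‖ ∧
      Real.exp (ν₂ * (t - s)) * ‖Φ s t₀ x (P₂ x v)‖ ≤ N₂ * ‖Φ t t₀ x (P₂ x v)‖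

/-- Barreira-Valls exponential dichotomy with respect to compatible projectors `P₁, P₂`. -/
def IsBVExpDichotomic (Φ : ℝ → ℝ → X → (V →L[ℝ] V))
    (P₁ P₂ : X → (V →L[ℝ] V)) : Prop :=
  ∃ N α₁ α₂ β₁ β₂ : ℝ, 1 ≤ N ∧ 0 < α₁ ∧ 0 < α₂ ∧ 0 < β₁ ∧ 0 < β₂ ∧
    ∀ t s t₀ (x : X) (v : V), 0 ≤ t₀ → t₀ ≤ s → s ≤ t →
      ‖Φ t t₀ x (P₁ x v)‖ ≤ N * Real.exp (-α₁ * t) * Real.exp (β₁ * s) * ‖Φ s t₀ x (P₁ x v)‖ ∧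
      ‖Φ s t₀ x (P₂ x v)‖ ≤ N * Real.exp (-α₂ * t) * Real.exp (β₂ * s) * ‖Φ t t₀ x (P₂ x v)‖

/-- (Nonuniform) exponential dichotomy with respect to compatible projectors `P₁, P₂`. -/
def IsExpDichotomic (Φ : ℝ → ℝ → X → (V →L[ℝ] V))
    (P₁ P₂ : X → (V →L[ℝ] V)) : Prop :=
  ∃ (N₁ N₂ : ℝ → ℝ) (ν₁ ν₂ : ℝ), (∀ s, 0 ≤ s → 0 < N₁ s) ∧ (∀ s, 0 ≤ s → 0 < N₂ s) ∧
    0 < ν₁ ∧ 0 < ν₂ ∧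
    ∀ t s t₀ (x : X) (v : V), 0 ≤ t₀ → t₀ ≤ s → s ≤ t →
      ‖Φ t t₀ x (P₁ x v)‖ ≤ N₁ s * Real.exp (-ν₁ * t) * ‖Φ s t₀ x (P₁ x v)‖ ∧
      ‖Φ s t₀ x (P₂ x v)‖ ≤ N₂ s * Real.exp (-ν₂ * t) * ‖Φ t t₀ x (P₂ x v)‖

/-- Uniform polynomial dichotomy with respect to compatible projectors `P₁, P₂`. -/
def IsUnifPolyDichotomic (Φ : ℝ → ℝ → X → (V →L[ℝ] V))
    (P₁ P₂ : X → (V →L[ℝ] V)) : Prop :=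
  ∃ N α₁ α₂ : ℝ, 1 ≤ N ∧ 0 < α₁ ∧ 0 < α₂ ∧
    ∀ t s (x : X) (v : V), 1 ≤ s → s ≤ t →
      ‖Φ t s x (P₁ x v)‖ ≤ N * t ^ (-α₁) * s ^ α₁ * ‖P₁ x v‖ ∧
      ‖P₂ x v‖ ≤ N * t ^ (-α₂) * s ^ α₂ * ‖Φ t s x (P₂ x v)‖

/-- Barreira-Valls polynomial dichotomy with respect to compatible projectors `P₁, P₂`. -/
def IsBVPolyDichotomic (Φ : ℝ → ℝ → X → (V →L[ℝ] V))
    (P₁ P₂ : X → (V →L[ℝ] V)) : Prop :=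
  ∃ N α₁ α₂ β₁ β₂ : ℝ, 1 ≤ N ∧ 0 < α₁ ∧ 0 < α₂ ∧ 0 < β₁ ∧ 0 < β₂ ∧
    ∀ t s (x : X) (v : V), 1 ≤ s → s ≤ t →
      ‖Φ t s x (P₁ x v)‖ ≤ N * t ^ (-α₁) * s ^ β₁ * ‖P₁ x v‖ ∧
      ‖P₂ x v‖ ≤ N * t ^ (-α₂) * s ^ β₂ * ‖Φ t s x (P₂ x v)‖

/-- (Nonuniform) polynomial dichotomy with respect to compatible projectors `P₁, P₂`. -/
def IsPolyDichotomic (Φ : ℝ → ℝ → X → (V →L[ℝ] V))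
    (P₁ P₂ : X → (V →L[ℝ] V)) : Prop :=
  ∃ (N : ℝ → ℝ) (α₁ α₂ : ℝ), (∀ s, 0 ≤ s → 1 ≤ N s) ∧ 0 < α₁ ∧ 0 < α₂ ∧
    ∀ t s (x : X) (v : V), 1 ≤ s → s ≤ t →
      ‖Φ t s x (P₁ x v)‖ ≤ N s * t ^ (-α₁) * ‖P₁ x v‖ ∧
      ‖P₂ x v‖ ≤ N s * t ^ (-α₂) * ‖Φ t s x (P₂ x v)‖

end SkewEvolution

/-- diagonal operator on `ℝ²` with the `ℓ¹` norm. -/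
noncomputable def diagOp (a b : ℝ) : WithLp 1 (ℝ × ℝ) →L[ℝ] WithLp 1 (ℝ × ℝ) :=
  ((WithLp.prodContinuousLinearEquiv 1 ℝ ℝ ℝ).symm.toContinuousLinearMap.comp
    ((a • ContinuousLinearMap.id ℝ ℝ).prodMap (b • ContinuousLinearMap.id ℝ ℝ))).comp
    (WithLp.prodContinuousLinearEquiv 1 ℝ ℝ ℝ).toContinuousLinearMap

theorem diagOp_apply (a b : ℝ) (v : WithLp 1 (ℝ × ℝ)) :
    diagOp a b v = WithLp.toLp 1 (a * v.fst, b * v.snd) := rfl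

theorem diagOp_norm (a b : ℝ) (v : WithLp 1 (ℝ × ℝ)) :
    ‖diagOp a b v‖ = |a * v.fst| + |b * v.snd| := by
  rw [diagOp_apply, WithLp.prod_norm_eq_of_L1]; rfl

theorem diagOp_comp (a b c d : ℝ) :
    (diagOp a b).comp (diagOp c d) = diagOp (a * c) (b * d) := by
  ext v
  rw [ContinuousLinearMap.comp_apply, diagOp_apply, diagOp_apply, diagOp_apply]
  simp [mul_assoc]

theorem diagOp_one : diagOp 1 1 = ContinuousLinearMap.id ℝ _ := by
  ext v
  rw [diagOp_apply, one_mul, one_mul]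
  rfl

theorem diagOp_sub (a b c d : ℝ) : diagOp a b - diagOp c d = diagOp (a - c) (b - d) := by
  ext v
  rw [_root_.sub_apply, diagOp_apply, diagOp_apply, diagOp_apply,
    ← WithLp.toLp_sub]
  congr 1
  ext <;> simp [sub_mul]

/-- there is a skew-evolution semiflow on `X × ℝ²` (with the `ℓ¹` norm) that is Barreira-Valls polynomially dichotomic but not Barreira-Valls exponentially dichotomic. -/
theorem exists_bvPolyDichotomic_not_bvExpDichotomic :
    ∃ (X : Type) (_ : MetricSpace X)
      (φ : ℝ → ℝ → X → X)
      (Φ : ℝ → ℝ → X → (WithLp 1 (ℝ × ℝ) →L[ℝ] WithLp 1 (ℝ × ℝ)))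
      (P₁ P₂ : X → (WithLp 1 (ℝ × ℝ) →L[ℝ] WithLp 1 (ℝ × ℝ))),
      IsSkewEvolutionSemiflow φ Φ ∧ CompatibleProjectors φ Φ P₁ P₂ ∧
      IsBVPolyDichotomic Φ P₁ P₂ ∧ ¬ IsBVExpDichotomic Φ P₁ P₂ := by
  refine ⟨Unit, inferInstance, fun _ _ x => x,
    fun t s _ => diagOp ((s + 1) / (t + 1)) ((t + 1) / (s + 1)),
    fun _ => diagOp 1 0, fun _ => diagOp 0 1, ⟨⟨?_, ?_⟩, ?_, ?_⟩, ⟨?_, ⟨⟨?_, ?_⟩, ?_⟩,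
      ⟨⟨?_, ?_⟩, ?_⟩⟩, ?_, ?_⟩
  · intros; rfl
  · intros; rfl
  · intro t x ht
    have : t + 1 ≠ 0 := by positivity
    simp only [div_self this, diagOp_one]
  · intro t s t₀ x h0 h1 h2
    have : t₀ + 1 ≠ 0 := by positivity
    have : s + 1 ≠ 0 := by have : 0 ≤ s := h0.trans h1
                           positivity
    have : t + 1 ≠ 0 := by have : 0 ≤ t := (h0.trans h1).trans h2
                           positivity
    simp only [diagOp_comp]
    congr 1 <;> field_simp
  · intro x
    rw [← diagOp_one, diagOp_sub]; norm_num
  · intro x; rw [diagOp_comp]; norm_num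
  · exact (diagOp 1 0).continuous.comp continuous_snd
  · intro t s x _ _
    simp only [diagOp_comp, mul_comm]
  · intro x; rw [diagOp_comp]; norm_num
  · exact (diagOp 0 1).continuous.comp continuous_snd
  · intro t s x _ _
    simp only [diagOp_comp, mul_comm]
  · refine ⟨2, 1, 1, 1, 1, by norm_num, one_pos, one_pos, one_pos, one_pos, ?_⟩
    intro t s x v hs hst
    have hs0 : 0 < s := by linarith
    have ht0 : 0 < t := by linarith
    simp only [← ContinuousLinearMap.comp_apply, diagOp_comp, diagOp_norm]
    simp only [mul_one, mul_zero, zero_mul, one_mul, abs_zero, add_zero, zero_add,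
      Real.rpow_neg_one, Real.rpow_one, abs_mul]
    rw [abs_of_pos (show 0 < (s + 1) / (t + 1) by positivity),
      abs_of_pos (show 0 < (t + 1) / (s + 1) by positivity)]
    constructor
    · apply mul_le_mul_of_nonneg_right _ (abs_nonneg _)
      rw [← div_eq_mul_inv, div_mul_eq_mul_div, div_le_div_iff₀ (by positivity) (by positivity)]
      nlinarith
    · rw [← mul_assoc]
      apply le_mul_of_one_le_left (abs_nonneg _)
      rw [← div_eq_mul_inv, div_mul_eq_mul_div, div_mul_div_comm, one_le_div (by positivity)]
      nlinarith
  · rintro ⟨N, α, α₂, β, β₂, hN, hα, -, -, -, h⟩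
    have ht : 0 < 4 * N / α ^ 2 + 1 := by positivity
    have hα2 : α ^ 2 * (4 * N / α ^ 2 + 1) = 4 * N + α ^ 2 := by field_simp
    have ht1 : 1 ≤ 4 * N / α ^ 2 + 1 := by
      have : 0 ≤ 4 * N / α ^ 2 := by positivity
      linarith
    generalize 4 * N / α ^ 2 + 1 = t at ht hα2 ht1
    have h1 := (h t 0 0 () (WithLp.toLp 1 (1, 0)) le_rfl le_rfl ht.le).1
    simp only [← ContinuousLinearMap.comp_apply, diagOp_comp, diagOp_norm] at h1
    have hf : (WithLp.toLp 1 ((1 : ℝ), (0 : ℝ))).fst = 1 := rfl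
    rw [hf] at h1
    simp only [mul_one, mul_zero, zero_mul, one_mul, abs_zero, add_zero, zero_add, div_one,
      Real.exp_zero, abs_one] at h1
    rw [abs_of_pos (by positivity), neg_mul, Real.exp_neg, ← div_eq_mul_inv,
      div_le_div_iff₀ (by positivity) (by positivity)] at h1
    have h2 := Real.quadratic_le_exp_of_nonneg (x := α * t) (by positivity)
    have h3 : (α * t) ^ 2 = (4 * N + α ^ 2) * t := by rw [← hα2]; ring
    have h4 : 0 < α * t := by positivity
    have h5 : 0 < α ^ 2 * t := by positivity
    nlinarith
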